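/- Let G, H be infinite finitely generated groups and F a common finite subgroup. Then G *_F H is quasi-isometric to G * H, and consequently α_p^*(G *_F H) = α_p^*(G * H) for all p ≥ 1. -/

import Mathlib

open scoped ENNReal

/-- The word length of `g` with respect to a (symmetrized) generating set `S`. -/
noncomputable def wordNorm {G : Type*} [Group G] (S : Set G) (g : G) : ℕ :=
  sInf {n : ℕ | ∃ l : List G, (∀ x ∈ l, x ∈ S ∨ x⁻¹ ∈ S) ∧ l.length = n ∧ l.prod = g}

/-- The word metric associated to a generating set `S`. -/
noncomputable def wordDist {G : Type*} [Group G] (S : Set G) (g h : G) : ℝ :=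
  (wordNorm S (g⁻¹ * h) : ℝ)

/-- The `ℓ^p` compression exponent with respect to a distance function `d`. -/
noncomputable def compExp (p : ℝ) {X : Type*} (d : X → X → ℝ) : ℝ :=
  sSup {α : ℝ | 0 ≤ α ∧ α ≤ 1 ∧
    ∃ (φ : X → lp (fun _ : ℕ => ℝ) (ENNReal.ofReal p)) (C : ℝ), 0 < C ∧
      ∀ x y : X, C⁻¹ * d x y ^ α - C ≤ ‖φ x - φ y‖ ∧ ‖φ x - φ y‖ ≤ C * d x y + C}

/-- The amalgamated free product `G *_F H` along homomorphisms `φ : F → G`, `ψ : F → H`: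
the quotient of the free product `G ∗ H` by the normal closure of the relations
`φ(f) = ψ(f)`. -/
abbrev Amalgam (G H F : Type*) [Group G] [Group H] [Group F]
    (φ : F →* G) (ψ : F →* H) : Type _ :=
  Monoid.Coprod G H ⧸ Subgroup.normalClosure
    {x : Monoid.Coprod G H | ∃ f : F,
      x = Monoid.Coprod.inl (φ f) * (Monoid.Coprod.inr (ψ f) : Monoid.Coprod G H)⁻¹}

/-- `Within R n x y` says that `y` can be reached from `x` by at most `n` steps along `R`. -/
inductive Within {X : Type*} (R : X → X → Prop) : ℕ → X → X → Prop
  | refl (n : ℕ) (x : X) : Within R n x x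
  | step {n : ℕ} {x y z : X} : R x y → Within R n y z → Within R (n + 1) x z

namespace Within

variable {X X' : Type*} {R : X → X → Prop} {R' : X' → X' → Prop}

theorem mono {m n : ℕ} {x y : X} (h : Within R m x y) (hmn : m ≤ n) : Within R n x y := by
  induction h generalizing n with
  | refl => exact .refl _ _
  | step hr _ ih =>
    obtain ⟨k, rfl⟩ : ∃ k, n = k + 1 := ⟨n - 1, by omega⟩
    exact .step hr (ih (by omega))

theorem trans {m n : ℕ} {x y z : X} (h : Within R m x y) (h' : Within R n y z) :
    Within R (m + n) x z := by
  induction h with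
  | refl => exact h'.mono (by omega)
  | step hr _ ih => exact (Within.step hr (ih h')).mono (by omega)

theorem single {x y : X} (h : R x y) : Within R 1 x y := .step h (.refl 0 y)

theorem symm (hR : ∀ x y, R x y → R y x) {n : ℕ} {x y : X} (h : Within R n x y) :
    Within R n y x := by
  induction h with
  | refl => exact .refl _ _
  | step hr _ ih => exact ih.trans (single (hR _ _ hr))

theorem map {f : X → X'} {L : ℕ} (hf : ∀ x y, R x y → Within R' L (f x) (f y))
    {n : ℕ} {x y : X} (h : Within R n x y) : Within R' (L * n) (f x) (f y) := by
  induction h with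
  | refl => exact .refl _ _
  | step hr _ ih => exact ((hf _ _ hr).trans ih).mono (by rw [Nat.mul_succ]; omega)

theorem map_rel {f : X → X'} (hf : ∀ x y, R x y → R' (f x) (f y))
    {n : ℕ} {x y : X} (h : Within R n x y) : Within R' n (f x) (f y) :=
  (h.map fun x y hxy => single (hf x y hxy)).mono (by omega)

end Within

/-- The maps `f` and `g` are coarsely Lipschitz and coarsely inverse to each other, for the path
metrics of the relations `R` and `R'`. -/
def CoarseEq {X X' : Type*} (R : X → X → Prop) (R' : X' → X' → Prop) (f : X → X') (g : X' → X) :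
    Prop :=
  ∃ L : ℕ, (∀ x y, R x y → Within R' L (f x) (f y)) ∧ (∀ x y, R' x y → Within R L (g x) (g y)) ∧
    (∀ x, Within R L (g (f x)) x) ∧ ∀ x, Within R' L (f (g x)) x

namespace CoarseEq

variable {X X' X'' : Type*} {R : X → X → Prop} {R' : X' → X' → Prop} {R'' : X'' → X'' → Prop}

theorem symm {f : X → X'} {g : X' → X} (h : CoarseEq R R' f g) : CoarseEq R' R g f := by
  obtain ⟨L, h1, h2, h3, h4⟩ := h
  exact ⟨L, h2, h1, h4, h3⟩

theorem trans {f : X → X'} {g : X' → X} {f' : X' → X''} {g' : X'' → X'}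
    (h : CoarseEq R R' f g) (h' : CoarseEq R' R'' f' g') :
    CoarseEq R R'' (f' ∘ f) (g ∘ g') := by
  obtain ⟨L, h1, h2, h3, h4⟩ := h
  obtain ⟨M, k1, k2, k3, k4⟩ := h'
  refine ⟨L * M + M * L + L + M, fun x y hxy => ((h1 x y hxy).map k1).mono (by omega),
    fun x y hxy => ((k2 x y hxy).map h2).mono (by omega), fun x => ?_, fun x => ?_⟩
  · exact (((k3 (f x)).map h2).trans (h3 x)).mono (by omega)
  · exact (((h4 (g' x)).map k1).trans (k4 x)).mono (by omega)

end CoarseEq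

/-- Two elements of a group that differ by a generator or its inverse. -/
def wordRel {G : Type*} [Group G] (S : Set G) (g h : G) : Prop :=
  g⁻¹ * h ∈ S ∨ (g⁻¹ * h)⁻¹ ∈ S

section WordMetric

variable {G : Type*} [Group G] {S : Set G}

theorem wordRel_symm (g h : G) (hgh : wordRel S g h) : wordRel S h g := by
  unfold wordRel at *
  have e : h⁻¹ * g = (g⁻¹ * h)⁻¹ := by group
  rw [e, inv_inv]
  exact hgh.symm

theorem wordRel_mul_left (c g h : G) (hgh : wordRel S g h) : wordRel S (c * g) (c * h) := by
  unfold wordRel at *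
  have e : (c * g)⁻¹ * (c * h) = g⁻¹ * h := by group
  rwa [e]

theorem within_wordRel_mul_list_prod (l : List G) (hl : ∀ x ∈ l, x ∈ S ∨ x⁻¹ ∈ S) (g : G) :
    Within (wordRel S) l.length g (g * l.prod) := by
  induction l generalizing g with
  | nil => simpa using Within.refl 0 g
  | cons a l ih =>
    have h1 : wordRel S g (g * a) := by simpa [wordRel] using hl a (by simp)
    have h2 := ih (fun x hx => hl x (by simp [hx])) (g * a)
    rw [List.prod_cons, ← mul_assoc]
    exact Within.step h1 h2

theorem exists_list_of_within {n : ℕ} {g h : G} (hgh : Within (wordRel S) n g h) :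
    ∃ l : List G, (∀ x ∈ l, x ∈ S ∨ x⁻¹ ∈ S) ∧ l.length ≤ n ∧ l.prod = g⁻¹ * h := by
  induction hgh with
  | refl => exact ⟨[], by simp, by simp, by simp⟩
  | @step n x y z hr _ ih =>
    obtain ⟨l, h1, h2, h3⟩ := ih
    refine ⟨(x⁻¹ * y) :: l, ?_, by simpa using h2, by simp [h3, mul_assoc]⟩
    intro w hw
    rcases List.mem_cons.1 hw with rfl | hw
    · exact hr
    · exact h1 w hw

theorem wordDist_le_of_within {n : ℕ} {g h : G} (hgh : Within (wordRel S) n g h) :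
    wordDist S g h ≤ n := by
  obtain ⟨l, h1, h2, h3⟩ := exists_list_of_within hgh
  unfold wordDist wordNorm
  have h4 : sInf {n : ℕ | ∃ l : List G, (∀ x ∈ l, x ∈ S ∨ x⁻¹ ∈ S) ∧ l.length = n ∧
      l.prod = g⁻¹ * h} ≤ l.length := Nat.sInf_le ⟨l, h1, rfl, h3⟩
  exact_mod_cast h4.trans h2

theorem within_wordNorm (hS : Subgroup.closure S = ⊤) (g h : G) :
    Within (wordRel S) (wordNorm S (g⁻¹ * h)) g h := by
  have hne : {n : ℕ | ∃ l : List G, (∀ x ∈ l, x ∈ S ∨ x⁻¹ ∈ S) ∧ l.length = n ∧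
      l.prod = g⁻¹ * h}.Nonempty := by
    have hmem : g⁻¹ * h ∈ (Subgroup.closure S).toSubmonoid := by simp [hS]
    rw [Subgroup.closure_toSubmonoid] at hmem
    obtain ⟨l, hl, hp⟩ := Submonoid.exists_list_of_mem_closure hmem
    exact ⟨_, l, hl, rfl, hp⟩
  obtain ⟨l, h1, h2, h3⟩ := Nat.sInf_mem hne
  have := within_wordRel_mul_list_prod l h1 g
  rw [h3, h2, mul_inv_cancel_left] at this
  exact this

theorem wordDist_nonneg (g h : G) : 0 ≤ wordDist S g h := Nat.cast_nonneg _

end WordMetric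

theorem CoarseEq.wordDist_le {G H : Type*} [Group G] [Group H] {S : Set G} {T : Set H}
    (hS : Subgroup.closure S = ⊤) (hT : Subgroup.closure T = ⊤) {f : G → H} {g : H → G}
    (h : CoarseEq (wordRel S) (wordRel T) f g) :
    ∃ L : ℝ, 0 < L ∧ (∀ a b, L⁻¹ * wordDist S a b - L ≤ wordDist T (f a) (f b) ∧
      wordDist T (f a) (f b) ≤ L * wordDist S a b + L) ∧
      ∀ x, wordDist T x (f (g x)) ≤ L := by
  obtain ⟨L, h1, h2, h3, h4⟩ := h
  have hL0 : (0 : ℝ) ≤ L := Nat.cast_nonneg L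
  have up : ∀ a b, wordDist T (f a) (f b) ≤ L * wordDist S a b := fun a b => by
    have := wordDist_le_of_within ((within_wordNorm hS a b).map h1)
    push_cast at this
    exact this
  have low : ∀ a b, wordDist S a b ≤ L * wordDist T (f a) (f b) + 2 * L := fun a b => by
    have := wordDist_le_of_within ((((h3 a).symm wordRel_symm).trans
      ((within_wordNorm hT (f a) (f b)).map h2)).trans (h3 b))
    push_cast at this
    have e : wordDist T (f a) (f b) = (wordNorm T ((f a)⁻¹ * f b) : ℝ) := rfl
    rw [e]
    linarith
  refine ⟨L + 2, by positivity, fun a b => ⟨?_, ?_⟩, fun x => ?_⟩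
  · have hd := wordDist_nonneg (S := T) (f a) (f b)
    rw [sub_le_iff_le_add, inv_mul_le_iff₀ (by positivity)]
    nlinarith [low a b]
  · nlinarith [up a b, wordDist_nonneg (S := S) a b]
  · have := wordDist_le_of_within ((h4 x).symm wordRel_symm)
    linarith

theorem compExp_subset {p : ℝ} {X X' : Type*} {d : X → X → ℝ} {d' : X' → X' → ℝ}
    (hd : ∀ x y, 0 ≤ d x y) (hd' : ∀ x y, 0 ≤ d' x y) (f : X → X') {L : ℝ} (hL : 0 < L)
    (hf : ∀ a b, L⁻¹ * d a b - L ≤ d' (f a) (f b) ∧ d' (f a) (f b) ≤ L * d a b + L) :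
    {α : ℝ | 0 ≤ α ∧ α ≤ 1 ∧
      ∃ (φ : X' → lp (fun _ : ℕ => ℝ) (ENNReal.ofReal p)) (C : ℝ), 0 < C ∧
        ∀ x y, C⁻¹ * d' x y ^ α - C ≤ ‖φ x - φ y‖ ∧ ‖φ x - φ y‖ ≤ C * d' x y + C} ⊆
    {α : ℝ | 0 ≤ α ∧ α ≤ 1 ∧
      ∃ (φ : X → lp (fun _ : ℕ => ℝ) (ENNReal.ofReal p)) (C : ℝ), 0 < C ∧
        ∀ x y, C⁻¹ * d x y ^ α - C ≤ ‖φ x - φ y‖ ∧ ‖φ x - φ y‖ ≤ C * d x y + C} := by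
  rintro α ⟨h0, h1, φ, C, hC, h⟩
  have hLα : 0 < L ^ α := Real.rpow_pos_of_pos hL α
  refine ⟨h0, h1, φ ∘ f, C * L ^ α + C * L + C + L ^ α * C⁻¹ * L ^ α, by positivity, fun x y => ?_⟩
  obtain ⟨l1, l2⟩ := h (f x) (f y)
  obtain ⟨k1, k2⟩ := hf x y
  have hdx := hd x y
  have hdf := hd' (f x) (f y)
  set D := C * L ^ α + C * L + C + L ^ α * C⁻¹ * L ^ α with hD
  have hDpos : 0 < D := by positivity
  constructor
  · have key : d x y ^ α ≤ L ^ α * d' (f x) (f y) ^ α + L ^ α * L ^ α := by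
      calc d x y ^ α ≤ (L * d' (f x) (f y) + L * L) ^ α := by
            apply Real.rpow_le_rpow hdx _ h0
            rw [sub_le_iff_le_add, inv_mul_le_iff₀ hL] at k1
            linarith
        _ ≤ (L * d' (f x) (f y)) ^ α + (L * L) ^ α :=
            Real.rpow_add_le_add_rpow (by positivity) (by positivity) h0 h1
        _ = _ := by rw [Real.mul_rpow hL.le hdf, Real.mul_rpow hL.le hL.le]
    have hN : d' (f x) (f y) ^ α ≤ C * ‖φ (f x) - φ (f y)‖ + C * C := by
      rw [sub_le_iff_le_add, inv_mul_le_iff₀ hC] at l1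
      linarith
    change D⁻¹ * d x y ^ α - D ≤ ‖φ (f x) - φ (f y)‖
    rw [sub_le_iff_le_add, inv_mul_le_iff₀ hDpos]
    have hnn : 0 ≤ ‖φ (f x) - φ (f y)‖ := by
      simpa using lp.norm_nonneg' (φ (f x) - φ (f y))
    have e1 : L ^ α * (C * C) + L ^ α * L ^ α ≤ D * D := by
      have : L ^ α * L ^ α = C * (L ^ α * C⁻¹ * L ^ α) := by field_simp
      rw [this]
      have : L ^ α * (C * C) = C * (C * L ^ α) := by ring
      rw [this, ← mul_add]
      have a1 : 0 < C * L ^ α := by positivity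
      have a2 : 0 < C * L := by positivity
      have a3 : 0 < L ^ α * C⁻¹ * L ^ α := by positivity
      apply mul_le_mul <;> first | positivity | (rw [hD]; linarith)
    have e2 : L ^ α * C ≤ D := by
      have a2 : 0 < C * L := by positivity
      have a3 : 0 < L ^ α * C⁻¹ * L ^ α := by positivity
      rw [hD]; linarith
    nlinarith [mul_le_mul_of_nonneg_left hN hLα.le, mul_le_mul_of_nonneg_right e2 hnn]
  · have a1 : 0 < C * L ^ α := by positivity
    have a3 : 0 < L ^ α * C⁻¹ * L ^ α := by positivity
    change ‖φ (f x) - φ (f y)‖ ≤ D * d x y + D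
    have e1 : C * L ≤ D := by rw [hD]; linarith
    have e2 : C * L + C ≤ D := by rw [hD]; linarith
    nlinarith [mul_le_mul_of_nonneg_left k2 hC.le, mul_le_mul_of_nonneg_right e1 hdx]

/-- A tree of spaces on the set `Y`: `Y` is partitioned into copies of the pointed set `(A, a₀)`,
indexed by `S`, and into copies of the pointed set `(B, b₀)`, indexed by `K`. Apart from the root,
every point is the base point of exactly one of the two copies containing it, and the base point
of a copy is closer to the root than the other points of the copy. -/
structure TreeOfSpaces {A : Type*} (a₀ : A) {B : Type*} (b₀ : B) (S K Y : Type*) where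
  copyA : S × A ≃ Y
  copyB : K × B ≃ Y
  root : Y
  height : Y → ℕ
  base_or : ∀ y, (copyA.symm y).2 = a₀ ∨ (copyB.symm y).2 = b₀
  eq_root : ∀ y, (copyA.symm y).2 = a₀ → (copyB.symm y).2 = b₀ → y = root
  root_baseA : (copyA.symm root).2 = a₀
  root_baseB : (copyB.symm root).2 = b₀
  height_ltA : ∀ s a, a ≠ a₀ → height (copyA (s, a₀)) < height (copyA (s, a))
  height_ltB : ∀ k b, b ≠ b₀ → height (copyB (k, b₀)) < height (copyB (k, b))

namespace TreeOfSpaces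

variable {A : Type*} {a₀ : A} {B : Type*} {b₀ : B} {S K Y : Type*}

/-- Exchange the roles of the two pointed sets. -/
def swap (T : TreeOfSpaces a₀ b₀ S K Y) : TreeOfSpaces b₀ a₀ K S Y where
  copyA := T.copyB
  copyB := T.copyA
  root := T.root
  height := T.height
  base_or y := (T.base_or y).symm
  eq_root y h h' := T.eq_root y h' h
  root_baseA := T.root_baseB
  root_baseB := T.root_baseA
  height_ltA := T.height_ltB
  height_ltB := T.height_ltA

/-- Two points are adjacent if they are adjacent in a common copy of one of the two sets. -/
def Adj (T : TreeOfSpaces a₀ b₀ S K Y) (rA : A → A → Prop) (rB : B → B → Prop) (y y' : Y) : Prop :=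
  (∃ s a a', rA a a' ∧ T.copyA (s, a) = y ∧ T.copyA (s, a') = y') ∨
    ∃ k b b', rB b b' ∧ T.copyB (k, b) = y ∧ T.copyB (k, b') = y'

variable (T : TreeOfSpaces a₀ b₀ S K Y)

theorem adj_swap (rA : A → A → Prop) (rB : B → B → Prop) : T.swap.Adj rB rA = T.Adj rA rB := by
  funext y y'
  exact propext Or.comm

theorem adj_symm {rA : A → A → Prop} {rB : B → B → Prop} (hA : ∀ a a', rA a a' → rA a' a)
    (hB : ∀ b b', rB b b' → rB b' b) (y y' : Y) (h : T.Adj rA rB y y') : T.Adj rA rB y' y := by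
  rcases h with ⟨s, a, a', h, h1, h2⟩ | ⟨s, a, a', h, h1, h2⟩
  · exact .inl ⟨s, a', a, hA _ _ h, h2, h1⟩
  · exact .inr ⟨s, a', a, hB _ _ h, h2, h1⟩

theorem within_copyA {rA : A → A → Prop} (rB : B → B → Prop) {n : ℕ} {a a' : A}
    (h : Within rA n a a') (s : S) :
    Within (T.Adj rA rB) n (T.copyA (s, a)) (T.copyA (s, a')) :=
  h.map_rel (f := fun a => T.copyA (s, a)) fun a a' h => .inl ⟨s, a, a', h, rfl, rfl⟩

theorem within_copyB (rA : A → A → Prop) {rB : B → B → Prop} {n : ℕ} {b b' : B}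
    (h : Within rB n b b') (k : K) :
    Within (T.Adj rA rB) n (T.copyB (k, b)) (T.copyB (k, b')) :=
  h.map_rel (f := fun b => T.copyB (k, b)) fun b b' h => .inr ⟨k, b, b', h, rfl, rfl⟩

theorem height_leA (s : S) (a : A) : T.height (T.copyA (s, a₀)) ≤ T.height (T.copyA (s, a)) := by
  by_cases h : a = a₀
  · rw [h]
  · exact (T.height_ltA s a h).le

theorem copyA_base {y : Y} (h : (T.copyA.symm y).2 = a₀) :
    T.copyA ((T.copyA.symm y).1, a₀) = y := by
  rw [show ((T.copyA.symm y).1, a₀) = T.copyA.symm y from Prod.ext rfl h.symm,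
    Equiv.apply_symm_apply]

theorem copyB_base {y : Y} (h : (T.copyB.symm y).2 = b₀) :
    T.copyB ((T.copyB.symm y).1, b₀) = y := T.swap.copyA_base h

theorem baseA_of_ne (k : K) {b : B} (hb : b ≠ b₀) : (T.copyA.symm (T.copyB (k, b))).2 = a₀ :=
  (T.base_or _).resolve_right (by simpa using hb)

theorem baseB_of_ne (s : S) {a : A} (ha : a ≠ a₀) : (T.copyB.symm (T.copyA (s, a))).2 = b₀ :=
  T.swap.baseA_of_ne s ha

/-- The copy of `A` based at the root. -/
def IsRoot (s : S) : Prop := T.copyA (s, a₀) = T.root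

theorem baseB_of_isRoot {s : S} (h : T.IsRoot s) : (T.copyB.symm (T.copyA (s, a₀))).2 = b₀ := by
  rw [show T.copyA (s, a₀) = T.root from h, T.root_baseB]

/-- The copy of `A` through the point `b` of the copy of `B` through the point `a` of the copy `s`
of `A`. -/
def next (s : S) (a : A) (b : B) : S :=
  (T.copyA.symm (T.copyB ((T.copyB.symm (T.copyA (s, a))).1, b))).1

/-- The copy of `A` preceding the copy `s` on the way to the root, with the point where one has to
leave it in order to reach `s`. -/
def prev (s : S) : S × A :=
  T.copyA.symm (T.copyB ((T.copyB.symm (T.copyA (s, a₀))).1, b₀))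

/-- The point of a copy of `B` at which the copy `s` of `A` is attached. -/
def prevB (s : S) : B := (T.copyB.symm (T.copyA (s, a₀))).2

theorem copyA_next (s : S) (a : A) {b : B} (hb : b ≠ b₀) :
    T.copyA (T.next s a b, a₀) = T.copyB ((T.copyB.symm (T.copyA (s, a))).1, b) :=
  T.copyA_base (T.baseA_of_ne _ hb)

theorem next_prev (s : S) : T.next (T.prev s).1 (T.prev s).2 (T.prevB s) = s := by
  simp [next, prev, prevB]

theorem prev_next {s : S} {a : A} (h : (T.copyB.symm (T.copyA (s, a))).2 = b₀) {b : B}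
    (hb : b ≠ b₀) : T.prev (T.next s a b) = (s, a) := by
  rw [prev, T.copyA_next s a hb, Equiv.symm_apply_apply, T.copyB_base h, Equiv.symm_apply_apply]

theorem prevB_next (s : S) (a : A) {b : B} (hb : b ≠ b₀) : T.prevB (T.next s a b) = b := by
  rw [prevB, T.copyA_next s a hb, Equiv.symm_apply_apply]

theorem prevB_ne {s : S} (h : ¬ T.IsRoot s) : T.prevB s ≠ b₀ := fun h' =>
  h (T.eq_root _ (by simp) h')

theorem copyA_prev (s : S) :
    T.copyA (T.prev s) = T.copyB ((T.copyB.symm (T.copyA (s, a₀))).1, b₀) :=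
  Equiv.apply_symm_apply _ _

theorem copyB_prevB (s : S) :
    T.copyB ((T.copyB.symm (T.copyA (s, a₀))).1, T.prevB s) = T.copyA (s, a₀) :=
  Equiv.apply_symm_apply _ _

theorem height_prev_lt {s : S} (h : ¬ T.IsRoot s) :
    T.height (T.copyA ((T.prev s).1, a₀)) < T.height (T.copyA (s, a₀)) := by
  refine (T.height_leA _ (T.prev s).2).trans_lt ?_
  have hlt := T.height_ltB (T.copyB.symm (T.copyA (s, a₀))).1 _ (T.prevB_ne h)
  rwa [T.copyB_prevB, ← T.copyA_prev] at hlt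

theorem not_isRoot_next (s : S) (a : A) {b : B} (hb : b ≠ b₀) : ¬ T.IsRoot (T.next s a b) := by
  intro h
  have := T.prevB_next s a hb
  rw [prevB, T.baseB_of_isRoot h] at this
  exact hb this.symm

theorem height_next_lt {s : S} {a : A} (h : (T.copyB.symm (T.copyA (s, a))).2 = b₀) {b : B}
    (hb : b ≠ b₀) : T.height (T.copyA (s, a)) < T.height (T.copyA (T.next s a b, a₀)) := by
  rw [T.copyA_next s a hb]
  conv_lhs => rw [← T.copyB_base h]
  exact T.height_ltB _ _ hb

end TreeOfSpaces

/-- Data for replacing the pointed set `(P, p₀)` in a tree of spaces by a pointed set `(A, a₀)`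
that maps onto it. -/
structure Refinement {A : Type*} (a₀ : A) {P : Type*} (p₀ : P) {B : Type*} (b₀ : B) where
  p₁ : P
  p₂ : P
  ne₁ : p₁ ≠ p₀
  ne₂ : p₂ ≠ p₀
  ne₁₂ : p₁ ≠ p₂
  proj : A → P
  sec : P → A
  proj_sec : ∀ p, proj (sec p) = p
  sec_base : sec p₀ = a₀
  label : A → B
  label_ne : ∀ a, label a ≠ b₀
  label_inj : ∀ a a', label a = label a' → (proj a = proj a' → a = a') ∧
    (proj a = p₀ ↔ proj a' = p₀) ∧ (proj a = p₁ ↔ proj a' = p₁)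

namespace Refinement

variable {A : Type*} {a₀ : A} {P : Type*} {p₀ : P} {B : Type*} {b₀ : B}
  (D : Refinement a₀ p₀ b₀)

open Classical in
/-- A perturbation of the projection `A → P` such that, away from the root, only the base point
lies over `p₀` and, in deprived copies, nothing lies over `p₁`. -/
noncomputable def redirect (isRoot deprived : Prop) (a : A) : P :=
  if isRoot then D.proj a
  else if a = a₀ then p₀
  else if D.proj a = p₀ ∨ D.proj a = D.p₁ then
    if deprived then D.p₂ else D.p₁
  else D.proj a

theorem proj_base : D.proj a₀ = p₀ := by
  simpa [D.sec_base] using D.proj_sec p₀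

theorem redirect_ne {r d : Prop} (hr : ¬ r) (hd : d) (a : A) : D.redirect r d a ≠ D.p₁ := by
  have h1 := D.ne₁
  have h2 := D.ne₁₂
  unfold redirect
  split_ifs with h h' <;> first | exact h1.symm | exact h2.symm | tauto

theorem redirect_sec {r d : Prop} {p : P} (h : ¬ (¬ r ∧ d ∧ p = D.p₁)) :
    D.redirect r d (D.sec p) = p := by
  have h1 := D.proj_sec p
  have h2 := D.proj_base
  have h3 : D.sec p = a₀ ↔ p = p₀ :=
    ⟨fun e => by rw [← h1, e, h2], fun e => by rw [e, D.sec_base]⟩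
  unfold redirect
  rw [h1, h3]
  split_ifs <;> grind

theorem eq_base_of_redirect {r d : Prop} (hr : ¬ r) {a : A} (h : D.redirect r d a = p₀) :
    a = a₀ := by
  have h1 := D.ne₁
  have h2 := D.ne₂
  unfold redirect at h
  split_ifs at h <;> tauto

theorem redirect_inj {r d : Prop} {a a' : A} (h : D.redirect r d a = D.redirect r d a')
    (hl : D.label a = D.label a') : a = a' := by
  obtain ⟨h1, h2, h3⟩ := D.label_inj a a' hl
  have h0 := D.proj_base
  have h4 := D.ne₁
  have h5 := D.ne₂
  by_cases hp : D.proj a = D.proj a'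
  · exact h1 hp
  · unfold redirect at h
    split_ifs at h <;> grind

variable {S K Y : Type*} (T : TreeOfSpaces p₀ b₀ S K Y)

/-- A copy of `P` is deprived if the tree attached at its point `p₁` gets attached elsewhere. -/
def Deprived (s : S) : Prop :=
  ¬ T.IsRoot s ∧ ∃ _ : ¬ T.IsRoot s, ∃ a : A,
    a ≠ D.sec (D.redirect (T.IsRoot (T.prev s).1) (Deprived (T.prev s).1) a) ∧
    D.redirect (T.IsRoot (T.prev s).1) (Deprived (T.prev s).1) a = (T.prev s).2 ∧
    D.label a = T.prevB s
termination_by T.height (T.copyA (s, p₀))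
decreasing_by all_goals exact T.height_prev_lt ‹_›

/-- The point of `P` near which the point `a` of `A` is placed. -/
noncomputable def pos (s : S) (a : A) : P := D.redirect (T.IsRoot s) (D.Deprived T s) a

theorem deprived_iff (s : S) : D.Deprived T s ↔ ¬ T.IsRoot s ∧ ∃ a : A,
    a ≠ D.sec (D.pos T (T.prev s).1 a) ∧ D.pos T (T.prev s).1 a = (T.prev s).2 ∧
    D.label a = T.prevB s := by
  rw [Deprived]
  unfold pos
  tauto

open Classical in
/-- The copies of `A` in the refined tree of spaces. -/
noncomputable def place (x : S × A) : Y :=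
  if x.2 = D.sec (D.pos T x.1 x.2) then T.copyA (x.1, D.pos T x.1 x.2)
  else T.copyA (T.next x.1 (D.pos T x.1 x.2) (D.label x.2), D.p₁)

theorem pos_sec {s : S} {p : P} (h : ¬ (D.Deprived T s ∧ p = D.p₁)) :
    D.pos T s (D.sec p) = p :=
  D.redirect_sec fun h' => h h'.2

theorem place_sec {s : S} {p : P} (h : ¬ (D.Deprived T s ∧ p = D.p₁)) :
    D.place T (s, D.sec p) = T.copyA (s, p) := by
  simp [place, D.pos_sec T h]

theorem place_base (s : S) : D.place T (s, a₀) = T.copyA (s, p₀) := by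
  have h := D.place_sec T (s := s) (p := p₀) fun h => D.ne₁ h.2.symm
  rwa [D.sec_base] at h

theorem baseB_pos {s : S} {a : A} (h : a ≠ D.sec (D.pos T s a)) :
    (T.copyB.symm (T.copyA (s, D.pos T s a))).2 = b₀ := by
  by_cases hp : D.pos T s a = p₀
  · by_cases hr : T.IsRoot s
    · rw [hp, T.baseB_of_isRoot hr]
    · have := D.eq_base_of_redirect hr hp
      rw [hp, D.sec_base] at h
      exact absurd this h
  · exact T.baseB_of_ne s hp

theorem deprived_next {s : S} {a : A} (h : a ≠ D.sec (D.pos T s a)) :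
    D.Deprived T (T.next s (D.pos T s a) (D.label a)) := by
  have hl := D.label_ne a
  rw [deprived_iff, T.prev_next (D.baseB_pos T h) hl, T.prevB_next _ _ hl]
  exact ⟨T.not_isRoot_next _ _ hl, a, h, rfl, rfl⟩

theorem pos_ne_of_deprived {s : S} (h : D.Deprived T s) (a : A) : D.pos T s a ≠ D.p₁ :=
  D.redirect_ne ((D.deprived_iff T s).1 h).1 h a

theorem place_injective : Function.Injective (D.place T) := by
  rintro ⟨s, a⟩ ⟨s', a'⟩ h
  unfold place at h
  dsimp only at h
  split_ifs at h with h1 h2 h2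
  · obtain ⟨rfl, h⟩ := Prod.mk.inj (T.copyA.injective h)
    rw [h1, h2, h]
  · obtain ⟨rfl, h⟩ := Prod.mk.inj (T.copyA.injective h)
    exact absurd h (D.pos_ne_of_deprived T (D.deprived_next T h2) a)
  · obtain ⟨rfl, h⟩ := Prod.mk.inj (T.copyA.injective h)
    exact absurd h.symm (D.pos_ne_of_deprived T (D.deprived_next T h1) a')
  · obtain ⟨h, -⟩ := Prod.mk.inj (T.copyA.injective h)
    have e1 := congrArg T.prev h
    rw [T.prev_next (D.baseB_pos T h1) (D.label_ne a),
      T.prev_next (D.baseB_pos T h2) (D.label_ne a')] at e1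
    have e2 := congrArg T.prevB h
    rw [T.prevB_next _ _ (D.label_ne a), T.prevB_next _ _ (D.label_ne a')] at e2
    obtain ⟨rfl, e1⟩ := Prod.mk.inj e1
    rw [D.redirect_inj e1 e2]

theorem exists_place_of_deprived {s : S} (h : D.Deprived T s) :
    ∃ a, D.pos T (T.prev s).1 a = (T.prev s).2 ∧ D.label a = T.prevB s ∧
      D.place T ((T.prev s).1, a) = T.copyA (s, D.p₁) := by
  obtain ⟨-, a, h1, h2, h3⟩ := (D.deprived_iff T s).1 h
  refine ⟨a, h2, h3, ?_⟩
  unfold place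
  dsimp only
  rw [if_neg h1, h2, h3, T.next_prev]

theorem place_surjective : Function.Surjective (D.place T) := by
  intro y
  obtain ⟨⟨s, p⟩, rfl⟩ := T.copyA.surjective y
  by_cases h : D.Deprived T s ∧ p = D.p₁
  · obtain ⟨a, -, -, ha⟩ := D.exists_place_of_deprived T h.1
    exact ⟨_, h.2 ▸ ha⟩
  · exact ⟨_, D.place_sec T h⟩

/-- The parametrization of the set `Y` by the copies of `A`. -/
noncomputable def placeEquiv : S × A ≃ Y :=
  Equiv.ofBijective (D.place T) (And.intro (D.place_injective T) (D.place_surjective T))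

theorem placeEquiv_apply (x : S × A) : D.placeEquiv T x = D.place T x := rfl

theorem placeEquiv_base (s : S) : D.placeEquiv T (s, a₀) = T.copyA (s, p₀) := D.place_base T s

theorem placeEquiv_symm_base_iff (y : Y) :
    ((D.placeEquiv T).symm y).2 = a₀ ↔ (T.copyA.symm y).2 = p₀ := by
  constructor
  · intro h
    have e : D.placeEquiv T (((D.placeEquiv T).symm y).1, a₀) = y := by
      rw [show (((D.placeEquiv T).symm y).1, a₀) = (D.placeEquiv T).symm y from
        Prod.ext rfl h.symm, Equiv.apply_symm_apply]
    rw [← e, D.placeEquiv_base, Equiv.symm_apply_apply]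
  · intro h
    rw [← T.copyA_base h, ← D.placeEquiv_base, Equiv.symm_apply_apply]

/-- The refined tree of spaces. -/
noncomputable def refine : TreeOfSpaces a₀ b₀ S K Y where
  copyA := D.placeEquiv T
  copyB := T.copyB
  root := T.root
  height := T.height
  base_or y := by rw [placeEquiv_symm_base_iff]; exact T.base_or y
  eq_root y h := T.eq_root y ((D.placeEquiv_symm_base_iff T y).1 h)
  root_baseA := (D.placeEquiv_symm_base_iff T _).2 T.root_baseA
  root_baseB := T.root_baseB
  height_ltA s a ha := by
    rw [D.placeEquiv_base, placeEquiv_apply]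
    unfold place
    dsimp only
    split_ifs with h
    · refine T.height_ltA _ _ fun hp => ha ?_
      rw [h, hp, D.sec_base]
    · exact (T.height_leA _ _).trans_lt ((T.height_next_lt (D.baseB_pos T h) (D.label_ne a)).trans
        (T.height_ltA _ _ D.ne₁))
  height_ltB := T.height_ltB

/-- Distances in `P` between the projection of a point and its perturbed version are bounded. -/
theorem exists_within_pos {rP : P → P → Prop} (hP : ∀ p p', ∃ n, Within rP n p p') :
    ∃ n, ∀ s a, Within rP n (D.pos T s a) (D.proj a) := by
  obtain ⟨n₁, h₁⟩ := hP D.p₂ p₀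
  obtain ⟨n₂, h₂⟩ := hP D.p₂ D.p₁
  obtain ⟨n₃, h₃⟩ := hP D.p₁ p₀
  refine ⟨n₁ + n₂ + n₃, fun s a => ?_⟩
  have h0 := D.proj_base
  unfold pos redirect
  split_ifs with h1 h2 h3 h4
  · exact .refl _ _
  · rw [h2, h0]; exact .refl _ _
  · rcases h3 with h | h <;> rw [h]
    · exact h₁.mono (by omega)
    · exact h₂.mono (by omega)
  · rcases h3 with h | h <;> rw [h]
    · exact h₃.mono (by omega)
    · exact .refl _ _
  · exact .refl _ _

theorem exists_within_map {rA : A → A → Prop} (hA : ∀ a a', ∃ n, Within rA n a a') (p p' : P) :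
    ∃ n, Within (Relation.Map rA D.proj D.proj) n p p' := by
  obtain ⟨n, h⟩ := hA (D.sec p) (D.sec p')
  refine ⟨n, ?_⟩
  have := h.map_rel (R' := Relation.Map rA D.proj D.proj) (f := D.proj)
    fun a a' h => ⟨a, a', h, rfl, rfl⟩
  rwa [D.proj_sec, D.proj_sec] at this

theorem exists_within_place {rA : A → A → Prop} {rB : B → B → Prop}
    (hA : ∀ a a', ∃ n, Within rA n a a') (hB : ∃ n, ∀ a, Within rB n (D.label a) b₀) :
    ∃ n, ∀ s a, Within (T.Adj (Relation.Map rA D.proj D.proj) rB) n (D.place T (s, a))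
      (T.copyA (s, D.proj a)) := by
  obtain ⟨n, hn⟩ := D.exists_within_pos T (D.exists_within_map hA)
  obtain ⟨m, hm⟩ := hB
  obtain ⟨l, hl⟩ := D.exists_within_map hA D.p₁ p₀
  refine ⟨n + m + l, fun s a => ?_⟩
  have h1 := T.within_copyA rB (hn s a) s
  unfold place
  dsimp only
  split_ifs with h
  · exact h1.mono (by omega)
  · have h2 := T.within_copyA rB hl (T.next s (D.pos T s a) (D.label a))
    have h3 := T.within_copyB (Relation.Map rA D.proj D.proj) (hm a)
      (T.copyB.symm (T.copyA (s, D.pos T s a))).1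
    rw [T.copyA_next _ _ (D.label_ne a)] at h2
    rw [T.copyB_base (D.baseB_pos T h)] at h3
    exact ((h2.trans h3).trans h1).mono (by omega)

theorem exists_within_sec {rA : A → A → Prop} (hsymm : ∀ a a', rA a a' → rA a' a)
    (hA : ∀ a a', ∃ n, Within rA n a a')
    (hfib : ∃ n, ∀ a a', D.proj a = D.proj a' → Within rA n a a') :
    ∃ n, ∀ s a, Within rA n a (D.sec (D.pos T s a)) := by
  obtain ⟨n, hn⟩ := hfib
  obtain ⟨m, hm⟩ := D.exists_within_pos T (D.exists_within_map hA)
  refine ⟨_, fun s a => (((hm s a).map (f := D.sec) (R' := rA) (L := n + 1 + n) ?_).symm hsymm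
    |> (hn a (D.sec (D.proj a)) (D.proj_sec _).symm).trans)⟩
  rintro _ _ ⟨a, a', h, rfl, rfl⟩
  exact ((hn _ _ (D.proj_sec _)).trans (Within.single h)).trans (hn _ _ (D.proj_sec _).symm)

theorem exists_within_refine {rA : A → A → Prop} {rB : B → B → Prop}
    (hsA : ∀ a a', rA a a' → rA a' a) (hsB : ∀ b b', rB b b' → rB b' b)
    (hA : ∀ a a', ∃ n, Within rA n a a')
    (hfib : ∃ n, ∀ a a', D.proj a = D.proj a' → Within rA n a a')
    (hB : ∃ n, ∀ a, Within rB n (D.label a) b₀) :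
    ∃ n, ∀ s p, Within ((D.refine T).Adj rA rB) n (T.copyA (s, p))
      (D.place T (s, D.sec p)) := by
  obtain ⟨n, hn⟩ := D.exists_within_sec T hsA hA hfib
  obtain ⟨m, hm⟩ := hB
  obtain ⟨l, hl⟩ := hA a₀ (D.sec D.p₁)
  refine ⟨n + m + l, fun s p => ?_⟩
  by_cases h : D.Deprived T s ∧ p = D.p₁
  · obtain ⟨hs, rfl⟩ := h
    obtain ⟨a, h1, h2, h3⟩ := D.exists_place_of_deprived T hs
    have e1 : D.place T ((T.prev s).1, D.sec (T.prev s).2) = T.copyA (T.prev s) :=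
      D.place_sec T fun h => D.pos_ne_of_deprived T h.1 a (h1.trans h.2)
    have k1 : Within ((D.refine T).Adj rA rB) n (D.place T ((T.prev s).1, a))
        (D.place T ((T.prev s).1, D.sec (D.pos T (T.prev s).1 a))) :=
      (D.refine T).within_copyA rB (hn (T.prev s).1 a) (T.prev s).1
    have k2 : Within ((D.refine T).Adj rA rB) m (T.copyB (_, b₀)) (T.copyB (_, D.label a)) :=
      (D.refine T).within_copyB rA ((hm a).symm hsB) (T.copyB.symm (T.copyA (s, p₀))).1
    have k3 : Within ((D.refine T).Adj rA rB) l (D.place T (s, a₀)) (D.place T (s, D.sec D.p₁)) :=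
      (D.refine T).within_copyA rB hl s
    rw [h1, e1, h3, T.copyA_prev] at k1
    rw [h2, T.copyB_prevB] at k2
    rw [D.place_base] at k3
    exact ((k1.trans k2).trans k3).mono (by omega)
  · rw [D.place_sec T h]
    exact .refl _ _

theorem coarseEq_refine {rA : A → A → Prop} {rB : B → B → Prop}
    (hsA : ∀ a a', rA a a' → rA a' a) (hsB : ∀ b b', rB b b' → rB b' b)
    (hA : ∀ a a', ∃ n, Within rA n a a')
    (hfib : ∃ n, ∀ a a', D.proj a = D.proj a' → Within rA n a a')
    (hB : ∃ n, ∀ a, Within rB n (D.label a) b₀) :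
    CoarseEq (T.Adj (Relation.Map rA D.proj D.proj) rB) ((D.refine T).Adj rA rB) id id := by
  obtain ⟨n, hn⟩ := D.exists_within_place T hA hB
  obtain ⟨m, hm⟩ := D.exists_within_refine T hsA hsB hA hfib hB
  obtain ⟨l, hl⟩ := hfib
  have hsP : ∀ p p', Relation.Map rA D.proj D.proj p p' → Relation.Map rA D.proj D.proj p' p := by
    rintro _ _ ⟨a, a', h, rfl, rfl⟩
    exact ⟨a', a, hsA _ _ h, rfl, rfl⟩
  refine ⟨(m + (l + 1 + l) + m) + (n + 1 + n), ?_, ?_, fun _ => .refl _ _, fun _ => .refl _ _⟩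
  · rintro _ _ (⟨s, _, _, ⟨a, a', h, rfl, rfl⟩, rfl, rfl⟩ | ⟨k, b, b', h, rfl, rfl⟩)
    · have h1 := ((hl _ _ (D.proj_sec (D.proj a))).trans (Within.single h)).trans
        (hl _ _ (D.proj_sec (D.proj a')).symm)
      have h2 := (D.refine T).within_copyA rB h1 s
      have h3 := ((hm s (D.proj a)).trans h2).trans
        ((hm s (D.proj a')).symm ((D.refine T).adj_symm hsA hsB))
      exact h3.mono (by omega)
    · exact ((D.refine T).within_copyB rA (Within.single h) k).mono (by omega)
  · rintro _ _ (⟨s, a, a', h, rfl, rfl⟩ | ⟨k, b, b', h, rfl, rfl⟩)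
    · have h2 := T.within_copyA rB
        (Within.single (show Relation.Map rA D.proj D.proj _ _ from ⟨a, a', h, rfl, rfl⟩)) s
      have h3 := ((hn s a).trans h2).trans ((hn s a').symm (T.adj_symm hsP hsB))
      exact h3.mono (by omega)
    · exact (T.within_copyB _ (Within.single h) k).mono (by omega)

end Refinement

section Words

variable {C : Type*} (kind : C → Bool) (good : C → Prop)

/-- Words in good letters of alternating kinds. -/
def AltWord : Type _ := {l : List C // l.IsChain (kind · ≠ kind ·) ∧ ∀ x ∈ l, good x}

/-- Alternating words that do not begin with a letter of kind `c`. -/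
def AltStem (c : Bool) : Type _ :=
  {w : AltWord kind good // ∀ x ∈ w.1.head?, kind x ≠ c}

variable {kind good} {A : Type*} {a₀ : A} {c : Bool} {ι : A → C}

open Classical in
/-- Prepend a letter of kind `c` to a word that does not begin with such a letter; the base point
stands for the empty letter. -/
noncomputable def AltStem.extend (hk : ∀ a, kind (ι a) = c) (hg : ∀ a, good (ι a) ↔ a ≠ a₀)
    (x : AltStem kind good c × A) : AltWord kind good :=
  if h : x.2 = a₀ then x.1.1
  else ⟨ι x.2 :: x.1.1.1, List.isChain_cons.2
    ⟨fun y hy => by rw [hk]; exact (x.1.2 y hy).symm, x.1.1.2.1⟩, by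
      simpa using ⟨(hg _).2 h, x.1.1.2.2⟩⟩

variable (hk : ∀ a, kind (ι a) = c) (hg : ∀ a, good (ι a) ↔ a ≠ a₀)

theorem AltStem.extend_base (s : AltStem kind good c) :
    AltStem.extend hk hg (s, a₀) = s.1 := by simp [AltStem.extend]

theorem AltStem.extend_of_ne (s : AltStem kind good c) {a : A} (ha : a ≠ a₀) :
    (AltStem.extend hk hg (s, a)).1 = ι a :: s.1.1 := by simp [AltStem.extend, ha]

theorem AltStem.extend_bijective (hι : Function.Injective ι)
    (hr : ∀ x, kind x = c → x ∈ Set.range ι) :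
    Function.Bijective (AltStem.extend hk hg) := by
  constructor
  · rintro ⟨s, a⟩ ⟨s', a'⟩ h
    have h' := congrArg Subtype.val h
    by_cases ha : a = a₀ <;> by_cases ha' : a' = a₀
    · subst ha
      subst ha'
      rw [extend_base, extend_base] at h
      rw [Subtype.ext h]
    · subst ha
      rw [extend_base, extend_of_ne _ _ _ ha'] at h'
      exact absurd (hk a') (s.2 (ι a') (by simp [h']))
    · subst ha'
      rw [extend_base, extend_of_ne _ _ _ ha] at h'
      exact absurd (hk a) (s'.2 (ι a) (by simp [← h']))
    · rw [extend_of_ne _ _ _ ha, extend_of_ne _ _ _ ha'] at h'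
      obtain ⟨h1, h2⟩ := List.cons.inj h'
      rw [hι h1, Subtype.ext (Subtype.ext h2)]
  · rintro ⟨l, hl, hl'⟩
    by_cases h : ∀ x ∈ l.head?, kind x ≠ c
    · exact ⟨(⟨⟨l, hl, hl'⟩, h⟩, a₀), extend_base _ _ _⟩
    · cases l with
      | nil => simp at h
      | cons x l =>
        obtain ⟨a, rfl⟩ := hr x (by simpa using h)
        have h1 := List.isChain_cons.1 hl
        have h2 : good (ι a) ∧ ∀ x ∈ l, good x := by simpa using hl'
        refine ⟨(⟨⟨l, h1.2, h2.2⟩, fun y hy => ?_⟩, a), Subtype.ext ?_⟩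
        · rw [← hk a]
          exact (h1.1 y hy).symm
        · exact AltStem.extend_of_ne _ _ _ ((hg a).1 h2.1)

/-- The parametrization of all alternating words by `AltStem.extend`. -/
noncomputable def AltStem.extendEquiv (hι : Function.Injective ι)
    (hr : ∀ x, kind x = c → x ∈ Set.range ι) : AltStem kind good c × A ≃ AltWord kind good :=
  Equiv.ofBijective _ (AltStem.extend_bijective hk hg hι hr)

theorem AltStem.extendEquiv_symm_base_iff (hι : Function.Injective ι)
    (hr : ∀ x, kind x = c → x ∈ Set.range ι) (w : AltWord kind good) :
    ((AltStem.extendEquiv hk hg hι hr).symm w).2 = a₀ ↔ ∀ x ∈ w.1.head?, kind x ≠ c := by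
  obtain ⟨⟨s, a⟩, rfl⟩ := (AltStem.extendEquiv hk hg hι hr).surjective w
  rw [Equiv.symm_apply_apply]
  change a = a₀ ↔ ∀ x ∈ (AltStem.extend hk hg (s, a)).1.head?, kind x ≠ c
  by_cases ha : a = a₀
  · subst ha
    rw [extend_base]
    exact iff_of_true rfl s.2
  · rw [extend_of_ne _ _ _ ha]
    simp [ha, hk]

end Words

/-- The tree of spaces made of alternating words in two pointed sets. -/
theorem TreeOfSpaces.exists_model {A : Type*} (a₀ : A) {B : Type*} (b₀ : B) :
    ∃ (kind : A ⊕ B → Bool) (good : A ⊕ B → Prop), Nonempty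
      (TreeOfSpaces a₀ b₀ (AltStem kind good true) (AltStem kind good false)
        (AltWord kind good)) := by
  let kind : A ⊕ B → Bool := Sum.isLeft
  let good : A ⊕ B → Prop := fun x => x ≠ .inl a₀ ∧ x ≠ .inr b₀
  have kA : ∀ a : A, kind (.inl a) = true := fun _ => rfl
  have kB : ∀ b : B, kind (.inr b) = false := fun _ => rfl
  have gA : ∀ a : A, good (.inl a) ↔ a ≠ a₀ := fun a => by simp [good]
  have gB : ∀ b : B, good (.inr b) ↔ b ≠ b₀ := fun b => by simp [good]
  have rA : ∀ x : A ⊕ B, kind x = true → x ∈ Set.range Sum.inl := by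
    rintro (a | b) h
    · exact ⟨a, rfl⟩
    · simp [kind] at h
  have rB : ∀ x : A ⊕ B, kind x = false → x ∈ Set.range Sum.inr := by
    rintro (a | b) h
    · simp [kind] at h
    · exact ⟨b, rfl⟩
  refine ⟨kind, good, ⟨{
    copyA := AltStem.extendEquiv kA gA Sum.inl_injective rA
    copyB := AltStem.extendEquiv kB gB Sum.inr_injective rB
    root := ⟨[], by simp, by simp⟩
    height := fun w => w.1.length
    base_or := fun y => ?_
    eq_root := fun y h h' => ?_
    root_baseA := ?_
    root_baseB := ?_
    height_ltA := fun s a ha => ?_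
    height_ltB := fun s a ha => ?_ }⟩⟩
  · rw [AltStem.extendEquiv_symm_base_iff, AltStem.extendEquiv_symm_base_iff]
    obtain ⟨l, hl⟩ := y
    cases l with
    | nil => simp
    | cons x l => cases h : kind x <;> simp [h]
  · rw [AltStem.extendEquiv_symm_base_iff] at h h'
    obtain ⟨l, hl⟩ := y
    cases l with
    | nil => rfl
    | cons x l => cases hx : kind x <;> simp [hx] at h h'
  · exact (AltStem.extendEquiv_symm_base_iff _ _ _ _ _).2 (by simp)
  · exact (AltStem.extendEquiv_symm_base_iff _ _ _ _ _).2 (by simp)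
  · change (AltStem.extend kA gA _).1.length < (AltStem.extend kA gA _).1.length
    rw [AltStem.extend_base, AltStem.extend_of_ne _ _ _ ha]
    simp
  · change (AltStem.extend kB gB _).1.length < (AltStem.extend kB gB _).1.length
    rw [AltStem.extend_base, AltStem.extend_of_ne _ _ _ ha]
    simp

/-- A transversal, indexed by the pointed set `(P, p₀)`, of the image of `φ`. -/
structure Transversal {F G : Type*} [Group F] [Group G] (φ : F →* G) {P : Type*} (p₀ : P) where
  proj : G → P
  sec : P → G
  proj_sec_mul : ∀ p f, proj (sec p * φ f) = p
  exists_eq : ∀ g, ∃ f, g = sec (proj g) * φ f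
  sec_base : sec p₀ = 1
  injective : Function.Injective φ

namespace Transversal

variable {F G P : Type*} [Group F] [Group G] {φ : F →* G} {p₀ : P} (t : Transversal φ p₀)

theorem proj_sec (p : P) : t.proj (t.sec p) = p := by simpa using t.proj_sec_mul p 1

/-- The decomposition of a group given by a transversal. -/
noncomputable def equiv : P × F ≃ G where
  toFun x := t.sec x.1 * φ x.2
  invFun g := (t.proj g, (t.exists_eq g).choose)
  left_inv x := by
    have h := (t.exists_eq (t.sec x.1 * φ x.2)).choose_spec
    refine Prod.ext (t.proj_sec_mul _ _) (t.injective ?_)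
    exact (mul_left_cancel (h.trans (congrArg (t.sec · * _) (t.proj_sec_mul x.1 x.2)))).symm
  right_inv g := (t.exists_eq g).choose_spec.symm

theorem equiv_apply (p : P) (f : F) : t.equiv (p, f) = t.sec p * φ f := rfl

theorem equiv_symm_fst (g : G) : (t.equiv.symm g).1 = t.proj g := rfl

/-- The transversal of the trivial subgroup. -/
def trivial (G : Type*) [Group G] : Transversal (1 : Unit →* G) (1 : G) where
  proj := id
  sec := id
  proj_sec_mul p f := by simp
  exists_eq g := ⟨1, by simp⟩
  sec_base := rfl
  injective _ _ _ := rfl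

/-- A transversal for the left cosets of the image of an injective homomorphism. -/
theorem nonempty_quotient (hφ : Function.Injective φ) :
    Nonempty (Transversal φ ((1 : G) : G ⧸ φ.range)) := by
  classical
  let sec : G ⧸ φ.range → G := fun p => if p = ((1 : G) : G ⧸ φ.range) then 1 else p.out
  have hsec : ∀ p, ((sec p : G) : G ⧸ φ.range) = p := fun p => by
    by_cases h : p = ((1 : G) : G ⧸ φ.range)
    · simp [sec, h]
    · simp [sec, h]
  refine ⟨⟨fun g => (g : G ⧸ φ.range), sec, fun p f => ?_, fun g => ?_, by simp [sec], hφ⟩⟩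
  · rw [QuotientGroup.mk_mul_of_mem _ (MonoidHom.mem_range.2 ⟨f, rfl⟩), hsec]
  · obtain ⟨f, hf⟩ := QuotientGroup.eq.1 (hsec (g : G ⧸ φ.range))
    exact ⟨f, by rw [hf, mul_inv_cancel_left]⟩

end Transversal

namespace TreeOfSpaces

variable {A : Type*} {a₀ : A} {B : Type*} {b₀ : B} {S K Y : Type*} (T : TreeOfSpaces a₀ b₀ S K Y)

theorem height_base_ltA {y : Y} (h : (T.copyA.symm y).2 ≠ a₀) :
    T.height (T.copyA ((T.copyA.symm y).1, a₀)) < T.height y := by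
  conv_rhs => rw [← T.copyA.apply_symm_apply y]
  exact T.height_ltA _ _ h

theorem height_base_ltB {y : Y} (h : (T.copyB.symm y).2 ≠ b₀) :
    T.height (T.copyB ((T.copyB.symm y).1, b₀)) < T.height y := T.swap.height_base_ltA h

variable {M : Type*} [Monoid M] (u : A → M) (v : B → M)

open Classical in
/-- The product of the letters met on the way from the root to a point. -/
noncomputable def eval (y : Y) : M :=
  if _ : (T.copyA.symm y).2 ≠ a₀ then
    eval (T.copyA ((T.copyA.symm y).1, a₀)) * u (T.copyA.symm y).2
  else if _ : (T.copyB.symm y).2 ≠ b₀ then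
    eval (T.copyB ((T.copyB.symm y).1, b₀)) * v (T.copyB.symm y).2
  else 1
termination_by T.height y
decreasing_by
  · exact T.height_base_ltA ‹_›
  · exact T.height_base_ltB ‹_›

variable {u v}

theorem eval_root : T.eval u v T.root = 1 := by
  rw [eval, dif_neg (not_not.2 T.root_baseA), dif_neg (not_not.2 T.root_baseB)]

theorem eval_copyA (hu : u a₀ = 1) (s : S) (a : A) :
    T.eval u v (T.copyA (s, a)) = T.eval u v (T.copyA (s, a₀)) * u a := by
  by_cases h : a = a₀
  · rw [h, hu, mul_one]
  · rw [eval, dif_pos (by simpa using h), Equiv.symm_apply_apply]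

theorem eval_copyB (hv : v b₀ = 1) (k : K) (b : B) :
    T.eval u v (T.copyB (k, b)) = T.eval u v (T.copyB (k, b₀)) * v b := by
  by_cases h : b = b₀
  · rw [h, hv, mul_one]
  · rw [eval, dif_neg (not_not.2 (T.baseA_of_ne k h)), dif_pos (by simpa using h),
      Equiv.symm_apply_apply]

/-- Induction along the copies of the two sets, starting from the root. -/
theorem induction {motive : Y → Prop} (root : motive T.root)
    (stepA : ∀ s a, motive (T.copyA (s, a₀)) → motive (T.copyA (s, a)))
    (stepB : ∀ k b, motive (T.copyB (k, b₀)) → motive (T.copyB (k, b))) (y : Y) : motive y := by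
  induction hn : T.height y using Nat.strong_induction_on generalizing y with
  | _ n ih =>
    subst hn
    by_cases hA : (T.copyA.symm y).2 = a₀
    · by_cases hB : (T.copyB.symm y).2 = b₀
      · rwa [T.eq_root y hA hB]
      · rw [← T.copyB.apply_symm_apply y]
        exact stepB _ _ (ih _ (T.height_base_ltB hB) _ rfl)
    · rw [← T.copyA.apply_symm_apply y]
      exact stepA _ _ (ih _ (T.height_base_ltA hA) _ rfl)

end TreeOfSpaces

/-- The action of `G` on a union of copies of `G` by right multiplication. -/
def rightAction {G S Z : Type*} [Group G] (e : S × G ≃ Z) : G →* Equiv.Perm Z where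
  toFun g := e.symm.trans (((Equiv.refl S).prodCongr (Equiv.mulRight g⁻¹)).trans e)
  map_one' := by ext z; simp
  map_mul' g h := by
    refine Equiv.ext fun z => ?_
    obtain ⟨⟨s, x⟩, rfl⟩ := e.surjective z
    simp [mul_assoc]

theorem rightAction_apply {G S Z : Type*} [Group G] (e : S × G ≃ Z) (g : G) (s : S) (x : G) :
    rightAction e g (e (s, x)) = e (s, x * g⁻¹) := by simp [rightAction]

namespace Transversal

variable {F G P S Y : Type*} [Group F] [Group G] {φ : F →* G} {p₀ : P} (t : Transversal φ p₀)

/-- Copies of a group obtained from copies of a transversal. -/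
noncomputable def thicken (e : S × P ≃ Y) : S × G ≃ Y × F :=
  ((Equiv.refl S).prodCongr t.equiv.symm).trans
    ((Equiv.prodAssoc S P F).symm.trans (e.prodCongr (Equiv.refl F)))

theorem thicken_apply (e : S × P ≃ Y) (s : S) (p : P) (f : F) :
    t.thicken e (s, t.sec p * φ f) = (e (s, p), f) := by
  rw [← t.equiv_apply]
  simp [thicken]

theorem thicken_fst (e : S × P ≃ Y) (s : S) (g : G) :
    (t.thicken e (s, g)).1 = e (s, t.proj g) := by
  simp [thicken, t.equiv_symm_fst]

theorem thicken_one (e : S × P ≃ Y) (s : S) : t.thicken e (s, 1) = (e (s, p₀), 1) := by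
  simpa [t.sec_base] using t.thicken_apply e s p₀ 1

theorem rightAction_thicken (e : S × P ≃ Y) (f : F) (y : Y) (f' : F) :
    rightAction (t.thicken e) (φ f) (y, f') = (y, f' * f⁻¹) := by
  obtain ⟨⟨s, p⟩, rfl⟩ := e.surjective y
  rw [← t.thicken_apply, rightAction_apply, mul_assoc, ← map_inv, ← map_mul, t.thicken_apply]

end Transversal

section Orbit

variable {F G H P Q S K Y M : Type*} [Group F] [Group G] [Group H] [Group M]
  {φ : F →* G} {ψ : F →* H} {p₀ : P} {q₀ : Q} (t : Transversal φ p₀) (t' : Transversal ψ q₀)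
  (T : TreeOfSpaces p₀ q₀ S K Y) (i : G →* M) (j : H →* M)

/-- The product of the letters met on the way from the root to a point, with a final letter
in `F`. -/
noncomputable def evalThick (z : Y × F) : M :=
  T.eval (fun p => i (t.sec p)) (fun q => j (t'.sec q)) z.1 * i (φ z.2)

theorem evalThick_thickenA (s : S) (g : G) :
    evalThick t t' T i j (t.thicken T.copyA (s, g)) =
      T.eval (fun p => i (t.sec p)) (fun q => j (t'.sec q)) (T.copyA (s, p₀)) * i g := by
  obtain ⟨⟨p, f⟩, rfl⟩ := t.equiv.surjective g
  rw [t.equiv_apply, t.thicken_apply]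
  simp only [evalThick]
  rw [T.eval_copyA (by simp [t.sec_base]), mul_assoc, map_mul]

theorem evalThick_thickenB (hij : ∀ f, i (φ f) = j (ψ f)) (k : K) (h : H) :
    evalThick t t' T i j (t'.thicken T.copyB (k, h)) =
      T.eval (fun p => i (t.sec p)) (fun q => j (t'.sec q)) (T.copyB (k, q₀)) * j h := by
  obtain ⟨⟨p, f⟩, rfl⟩ := t'.equiv.surjective h
  rw [t'.equiv_apply, t'.thicken_apply]
  simp only [evalThick]
  rw [T.eval_copyB (by simp [t'.sec_base]), mul_assoc, map_mul, hij]

variable {t t' T i j} {θ : M →* Equiv.Perm (Y × F)}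

theorem evalThick_smul (hij : ∀ f, i (φ f) = j (ψ f)) (hgen : i.range ⊔ j.range = ⊤)
    (hi : ∀ g, θ (i g) = rightAction (t.thicken T.copyA) g)
    (hj : ∀ h, θ (j h) = rightAction (t'.thicken T.copyB) h) (x : M) (z : Y × F) :
    evalThick t t' T i j (θ x z) = evalThick t t' T i j z * x⁻¹ := by
  let N : Subgroup M :=
    { carrier := {x | ∀ z, evalThick t t' T i j (θ x z) = evalThick t t' T i j z * x⁻¹}
      one_mem' := fun z => by simp
      mul_mem' := fun {x y} hx hy z => by
        rw [map_mul, Equiv.Perm.mul_apply, hx, hy, mul_inv_rev, mul_assoc]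
      inv_mem' := fun {x} hx z => by
        have := hx (θ x⁻¹ z)
        rw [← Equiv.Perm.mul_apply, ← map_mul, mul_inv_cancel, map_one, Equiv.Perm.one_apply]
          at this
        rw [this, inv_inv, inv_mul_cancel_right] }
  have hN : N = ⊤ := by
    rw [eq_top_iff, ← hgen, sup_le_iff]
    constructor
    · rintro _ ⟨g, rfl⟩ z
      obtain ⟨⟨s, x⟩, rfl⟩ := (t.thicken T.copyA).surjective z
      rw [hi, rightAction_apply, evalThick_thickenA, evalThick_thickenA, map_mul, map_inv,
        mul_assoc]
    · rintro _ ⟨g, rfl⟩ z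
      obtain ⟨⟨s, x⟩, rfl⟩ := (t'.thicken T.copyB).surjective z
      rw [hj, rightAction_apply, evalThick_thickenB _ _ _ _ _ hij,
        evalThick_thickenB _ _ _ _ _ hij, map_mul, map_inv, mul_assoc]
  have hx : x ∈ N := hN ▸ Subgroup.mem_top x
  exact hx z

theorem smul_eval (hi : ∀ g, θ (i g) = rightAction (t.thicken T.copyA) g)
    (hj : ∀ h, θ (j h) = rightAction (t'.thicken T.copyB) h) (y : Y) :
    θ (T.eval (fun p => i (t.sec p)) (fun q => j (t'.sec q)) y)⁻¹ (T.root, 1) = (y, 1) := by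
  induction y using T.induction with
  | root => rw [T.eval_root, inv_one, map_one, Equiv.Perm.one_apply]
  | stepA s p ih =>
    rw [T.eval_copyA (by simp [t.sec_base]), mul_inv_rev, map_mul, Equiv.Perm.mul_apply, ih,
      ← map_inv, hi, ← t.thicken_one, rightAction_apply]
    simpa using t.thicken_apply T.copyA s p 1
  | stepB s p ih =>
    rw [T.eval_copyB (by simp [t'.sec_base]), mul_inv_rev, map_mul, Equiv.Perm.mul_apply, ih,
      ← map_inv, hj, ← t'.thicken_one, rightAction_apply]
    simpa using t'.thicken_apply T.copyB s p 1

end Orbit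

theorem wordRel_map {G M : Type*} [Group G] [Group M] {S : Set G} {U : Set M} (i : G →* M)
    (h : i '' S ⊆ U) (c : M) (x y : G) (hxy : wordRel S x y) : wordRel U (c * i x) (c * i y) := by
  apply wordRel_mul_left
  unfold wordRel at *
  rw [← map_inv, ← map_mul, ← map_inv]
  exact hxy.imp (fun hx => h ⟨_, hx, rfl⟩) fun hx => h ⟨_, hx, rfl⟩

theorem Transversal.exists_within_map {F G P M : Type*} [Group F] [Group G] [Group M] [Finite F]
    {φ : F →* G} {p₀ : P} (t : Transversal φ p₀) {X : Set G} (hX : Subgroup.closure X = ⊤)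
    {U : Set M} (i : G →* M) (h : i '' X ⊆ U) :
    ∃ n, (∀ c f, Within (wordRel U) n c (c * i (φ f))) ∧
      ∀ c p p', Relation.Map (wordRel X) t.proj t.proj p p' →
        Within (wordRel U) n (c * i (t.sec p)) (c * i (t.sec p')) := by
  obtain ⟨n, hn⟩ := (Set.finite_range fun f => wordNorm X (1⁻¹ * φ f)).bddAbove
  have h1 : ∀ c f, Within (wordRel U) n c (c * i (φ f)) := fun c f => by
    have := (within_wordNorm hX 1 (φ f)).map_rel (wordRel_map i h c)
    rw [map_one, mul_one] at this
    exact this.mono (hn ⟨f, rfl⟩)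
  refine ⟨n + 1 + n, fun c f => (h1 c f).mono (by omega), ?_⟩
  rintro c _ _ ⟨g, g', hg, rfl, rfl⟩
  obtain ⟨f, hf⟩ := t.exists_eq g
  obtain ⟨f', hf'⟩ := t.exists_eq g'
  have h2 := h1 (c * i (t.sec (t.proj g))) f
  have h3 := h1 (c * i (t.sec (t.proj g'))) f'
  rw [mul_assoc, ← map_mul, ← hf] at h2
  rw [mul_assoc, ← map_mul, ← hf'] at h3
  exact (h2.trans (Within.single (wordRel_map i h c _ _ hg))).trans (h3.symm wordRel_symm)

theorem exists_coarseEq_tree {F G H P Q S K Y M : Type*} [Group F] [Group G] [Group H] [Group M]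
    [Finite F] {φ : F →* G} {ψ : F →* H} {p₀ : P} {q₀ : Q} (t : Transversal φ p₀)
    (t' : Transversal ψ q₀) (T : TreeOfSpaces p₀ q₀ S K Y) (i : G →* M) (j : H →* M)
    (hij : ∀ f, i (φ f) = j (ψ f)) (hgen : i.range ⊔ j.range = ⊤)
    (hlift : ∀ (α : G →* Equiv.Perm (Y × F)) (β : H →* Equiv.Perm (Y × F)),
      (∀ f, α (φ f) = β (ψ f)) → ∃ θ : M →* Equiv.Perm (Y × F),
        (∀ g, θ (i g) = α g) ∧ ∀ h, θ (j h) = β h)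
    {X : Set G} {X' : Set H} (hX : Subgroup.closure X = ⊤) (hX' : Subgroup.closure X' = ⊤) :
    ∃ f g, CoarseEq (wordRel (i '' X ∪ j '' X'))
      (T.Adj (Relation.Map (wordRel X) t.proj t.proj) (Relation.Map (wordRel X') t'.proj t'.proj))
      f g := by
  obtain ⟨θ, hi, hj⟩ := hlift (rightAction (t.thicken T.copyA)) (rightAction (t'.thicken T.copyB))
    fun f => by
      ext1 ⟨y, f'⟩
      rw [t.rightAction_thicken, t'.rightAction_thicken]
  set ev := T.eval (fun p => i (t.sec p)) (fun q => j (t'.sec q)) with hev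
  let o : M → Y × F := fun x => θ x⁻¹ (T.root, 1)
  have ho : ∀ x y, o (x * y) = θ y⁻¹ (o x) := fun x y => by
    change θ (x * y)⁻¹ (T.root, 1) = θ y⁻¹ (θ x⁻¹ (T.root, 1))
    rw [mul_inv_rev, map_mul, Equiv.Perm.mul_apply]
  have hevo : ∀ x, ev (o x).1 * i (φ (o x).2) = x := fun x => by
    have h1 := evalThick_smul hij hgen hi hj x⁻¹ (T.root, 1)
    have h0 : evalThick t t' T i j (T.root, 1) = 1 := by simp [evalThick, T.eval_root]
    rw [h0, one_mul, inv_inv] at h1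
    exact h1
  obtain ⟨n, hn, hnA⟩ := t.exists_within_map hX i
    (Set.subset_union_left : i '' X ⊆ i '' X ∪ j '' X')
  obtain ⟨m, -, hmB⟩ := t'.exists_within_map hX' j
    (Set.subset_union_right : j '' X' ⊆ i '' X ∪ j '' X')
  have key : ∀ x w, w ∈ i '' X ∪ j '' X' → T.Adj (Relation.Map (wordRel X) t.proj t.proj)
      (Relation.Map (wordRel X') t'.proj t'.proj) (o x).1 (o (x * w)).1 := by
    rintro x _ (⟨g, hg, rfl⟩ | ⟨h, hh, rfl⟩)
    · rw [ho, ← map_inv, hi]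
      obtain ⟨⟨s, g'⟩, hs⟩ := (t.thicken T.copyA).surjective (o x)
      rw [← hs, rightAction_apply, t.thicken_fst, t.thicken_fst]
      exact .inl ⟨s, _, _, ⟨g', g' * g⁻¹⁻¹, by simp [wordRel, hg], rfl, rfl⟩, rfl, rfl⟩
    · rw [ho, ← map_inv, hj]
      obtain ⟨⟨s, g'⟩, hs⟩ := (t'.thicken T.copyB).surjective (o x)
      rw [← hs, rightAction_apply, t'.thicken_fst, t'.thicken_fst]
      exact .inr ⟨s, _, _, ⟨g', g' * h⁻¹⁻¹, by simp [wordRel, hh], rfl, rfl⟩, rfl, rfl⟩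
  refine ⟨fun x => (o x).1, ev, n + m + 1, fun x y hxy => ?_, ?_, fun x => ?_, fun y => ?_⟩
  · refine (Within.single ?_).mono (Nat.le_add_left 1 _)
    rcases hxy with h | h
    · simpa using key x _ h
    · refine T.adj_symm ?_ ?_ _ _ (by simpa using key y _ h)
      · rintro _ _ ⟨a, a', h, rfl, rfl⟩
        exact ⟨a', a, wordRel_symm _ _ h, rfl, rfl⟩
      · rintro _ _ ⟨a, a', h, rfl, rfl⟩
        exact ⟨a', a, wordRel_symm _ _ h, rfl, rfl⟩
  · rintro _ _ (⟨s, p, p', h, rfl, rfl⟩ | ⟨k, q, q', h, rfl, rfl⟩)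
    · rw [hev, T.eval_copyA (by simp [t.sec_base]) s p, T.eval_copyA (by simp [t.sec_base]) s p']
      exact (hnA _ _ _ h).mono (by omega)
    · rw [hev, T.eval_copyB (by simp [t'.sec_base]) k q, T.eval_copyB (by simp [t'.sec_base]) k q']
      exact (hmB _ _ _ h).mono (by omega)
  · have := hn (ev (o x).1) (o x).2
    rw [hevo] at this
    exact this.mono (by omega)
  · have h1 : o (ev y) = (y, 1) := smul_eval hi hj y
    change Within _ _ (o (ev y)).1 y
    rw [h1]
    exact .refl _ _

section

variable {F G P : Type*} [Group F] [Group G] {φ : F →* G} {p₀ : P}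

theorem Transversal.exists_refinement [Finite F] [Infinite P] (t : Transversal φ p₀) {B : Type*}
    [Infinite B] (b₀ : B) :
    ∃ D : Refinement (1 : G) p₀ b₀, D.proj = t.proj ∧ (Set.range D.label).Finite := by
  classical
  obtain ⟨p₁, h₁⟩ := (Set.finite_singleton p₀).exists_notMem
  obtain ⟨p₂, h₂⟩ := (Set.toFinite {p₀, p₁}).exists_notMem
  simp only [Set.mem_singleton_iff, Set.mem_insert_iff, not_or] at h₁ h₂
  have : Infinite {b // b ≠ b₀} := (Set.finite_singleton b₀).infinite_compl.to_subtype
  obtain ⟨e⟩ : Nonempty (F × Fin 3 ↪ {b // b ≠ b₀}) := by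
    obtain ⟨n, ⟨e⟩⟩ := Finite.exists_equiv_fin (F × Fin 3)
    exact ⟨e.toEmbedding.trans (Fin.valEmbedding.trans (Infinite.natEmbedding _))⟩
  let place : P → Fin 3 := fun p => if p = p₀ then 0 else if p = p₁ then 1 else 2
  have hp₀ : ∀ p, p = p₀ ↔ place p = 0 := fun p => by simp only [place]; split_ifs <;> simp_all
  have hp₁ : ∀ p, p = p₁ ↔ place p = 1 := fun p => by
    by_cases h : p = p₁
    · simp [place, h, h₁]
    · simp only [place, h, if_false]
      split_ifs <;> simp
  let lab : G → F × Fin 3 := fun g => ((t.equiv.symm g).2, place (t.proj g))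
  refine ⟨⟨p₁, p₂, h₁, h₂.1, fun h => h₂.2 h.symm, t.proj, t.sec, t.proj_sec, t.sec_base,
    fun g => e (lab g), fun g => (e (lab g)).2, fun g g' h => ?_⟩, rfl, ?_⟩
  · have h' := Prod.ext_iff.1 (e.injective (Subtype.ext h))
    refine ⟨fun hg => t.equiv.symm.injective (Prod.ext ?_ h'.1), ?_, ?_⟩
    · rwa [t.equiv_symm_fst, t.equiv_symm_fst]
    · rw [hp₀, hp₀, show place (t.proj g) = place (t.proj g') from h'.2]
    · rw [hp₁, hp₁, show place (t.proj g) = place (t.proj g') from h'.2]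
  · refine (Set.finite_range fun x => (e x : B)).subset ?_
    rintro _ ⟨g, rfl⟩
    exact ⟨lab g, rfl⟩

theorem Transversal.exists_within_of_proj_eq [Finite F] (t : Transversal φ p₀) {X : Set G}
    (hX : Subgroup.closure X = ⊤) :
    ∃ n, ∀ g g', t.proj g = t.proj g' → Within (wordRel X) n g g' := by
  obtain ⟨n, hn, -⟩ := t.exists_within_map hX (U := X) (MonoidHom.id G) (by simp)
  refine ⟨n + n, fun g g' h => ?_⟩
  obtain ⟨f, hf⟩ := t.exists_eq g
  obtain ⟨f', hf'⟩ := t.exists_eq g'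
  have h1 := hn (t.sec (t.proj g)) f
  have h2 := hn (t.sec (t.proj g')) f'
  rw [MonoidHom.id_apply, ← hf] at h1
  rw [MonoidHom.id_apply, ← hf', ← h] at h2
  exact (h1.symm wordRel_symm).trans h2

theorem Transversal.exists_coarseEq_refine [Finite F] [Infinite P] (t : Transversal φ p₀)
    {X : Set G} (hX : Subgroup.closure X = ⊤) {B S K Y : Type*} [Infinite B] {b₀ : B}
    (T : TreeOfSpaces p₀ b₀ S K Y) {rB : B → B → Prop} (hsB : ∀ b b', rB b b' → rB b' b)
    (hB : ∀ b b', ∃ n, Within rB n b b') :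
    ∃ T' : TreeOfSpaces (1 : G) b₀ S K Y,
      CoarseEq (T.Adj (Relation.Map (wordRel X) t.proj t.proj) rB) (T'.Adj (wordRel X) rB)
        id id := by
  obtain ⟨D, hD, hfin⟩ := t.exists_refinement b₀
  refine ⟨D.refine T, ?_⟩
  rw [← hD]
  refine D.coarseEq_refine T wordRel_symm hsB (fun g g' => ⟨_, within_wordNorm hX g g'⟩) ?_ ?_
  · rw [hD]
    exact t.exists_within_of_proj_eq hX
  · choose d hd using fun b => hB b b₀
    obtain ⟨n, hn⟩ := (hfin.image d).bddAbove
    exact ⟨n, fun g => (hd _).mono (hn ⟨_, ⟨g, rfl⟩, rfl⟩)⟩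

theorem relationMap_symm {X X' : Type*} {R : X → X → Prop} (hR : ∀ x y, R x y → R y x)
    (f : X → X') (x y : X') (h : Relation.Map R f f x y) : Relation.Map R f f y x := by
  obtain ⟨a, b, h, rfl, rfl⟩ := h
  exact ⟨b, a, hR _ _ h, rfl, rfl⟩

theorem Transversal.exists_within_relationMap (t : Transversal φ p₀) {X : Set G}
    (hX : Subgroup.closure X = ⊤) (p p' : P) :
    ∃ n, Within (Relation.Map (wordRel X) t.proj t.proj) n p p' := by
  have h := (within_wordNorm hX (t.sec p) (t.sec p')).map_rel
    (R' := Relation.Map (wordRel X) t.proj t.proj) (f := t.proj)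
    fun x y hxy => ⟨x, y, hxy, rfl, rfl⟩
  rw [t.proj_sec, t.proj_sec] at h
  exact ⟨_, h⟩

theorem infinite_quotient_range [Finite F] [Infinite G] (φ : F →* G) : Infinite (G ⧸ φ.range) := by
  by_contra h
  rw [not_infinite_iff_finite] at h
  have : Finite φ.range := (Set.finite_range φ).to_subtype
  exact not_finite_iff_infinite.2 ‹_›
    (Finite.of_equiv _ (Subgroup.groupEquivQuotientProdSubgroup (s := φ.range)).symm)

end

section Amalgam

variable {G H F : Type*} [Group G] [Group H] [Group F] (φ : F →* G) (ψ : F →* H)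

/-- The homomorphism from the first factor to an amalgamated free product. -/
def Amalgam.inl : G →* Amalgam G H F φ ψ := (QuotientGroup.mk' _).comp Monoid.Coprod.inl

/-- The homomorphism from the second factor to an amalgamated free product. -/
def Amalgam.inr : H →* Amalgam G H F φ ψ := (QuotientGroup.mk' _).comp Monoid.Coprod.inr

theorem Amalgam.inl_eq_inr (f : F) : Amalgam.inl φ ψ (φ f) = Amalgam.inr φ ψ (ψ f) := by
  rw [eq_comm]
  refine QuotientGroup.eq.2 ?_
  have h := Subgroup.Normal.conj_mem (Subgroup.normalClosure_normal (s := {x : Monoid.Coprod G H |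
    ∃ f : F, x = Monoid.Coprod.inl (φ f) * (Monoid.Coprod.inr (ψ f) : Monoid.Coprod G H)⁻¹}))
    _ (Subgroup.subset_normalClosure ⟨f, rfl⟩) (Monoid.Coprod.inr (ψ f))⁻¹
  simpa [mul_assoc] using h

theorem Amalgam.range_inl_sup_range_inr :
    (Amalgam.inl φ ψ).range ⊔ (Amalgam.inr φ ψ).range = ⊤ := by
  rw [Amalgam.inl, Amalgam.inr, MonoidHom.range_comp, MonoidHom.range_comp, ← Subgroup.map_sup,
    Monoid.Coprod.range_inl_sup_range_inr, ← MonoidHom.range_eq_map, QuotientGroup.range_mk']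

theorem Amalgam.exists_lift {M : Type*} [Group M] (α : G →* M) (β : H →* M)
    (h : ∀ f, α (φ f) = β (ψ f)) :
    ∃ θ : Amalgam G H F φ ψ →* M,
      (∀ g, θ (Amalgam.inl φ ψ g) = α g) ∧ ∀ h, θ (Amalgam.inr φ ψ h) = β h := by
  refine ⟨QuotientGroup.lift _ (Monoid.Coprod.lift α β) ?_, fun g => ?_, fun g => ?_⟩
  · refine Subgroup.normalClosure_le_normal ?_
    rintro _ ⟨f, rfl⟩
    simp [MonoidHom.mem_ker, h]
  · exact Monoid.Coprod.lift_apply_inl α β g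
  · exact Monoid.Coprod.lift_apply_inr α β g

theorem closure_image_union_image {M : Type*} [Group M] {i : G →* M} {j : H →* M}
    (hgen : i.range ⊔ j.range = ⊤) {X : Set G} {X' : Set H} (hX : Subgroup.closure X = ⊤)
    (hX' : Subgroup.closure X' = ⊤) : Subgroup.closure (i '' X ∪ j '' X') = ⊤ := by
  rw [Subgroup.closure_union, ← MonoidHom.map_closure, ← MonoidHom.map_closure, hX, hX',
    ← MonoidHom.range_eq_map, ← MonoidHom.range_eq_map, hgen]

theorem Amalgam.exists_coarseEq_coprod [Infinite G] [Infinite H] [Finite F]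
    (hφ : Function.Injective φ) (hψ : Function.Injective ψ) {X : Set G} {X' : Set H}
    (hX : Subgroup.closure X = ⊤) (hX' : Subgroup.closure X' = ⊤) :
    ∃ f g, CoarseEq (wordRel (Amalgam.inl φ ψ '' X ∪ Amalgam.inr φ ψ '' X'))
      (wordRel ((Monoid.Coprod.inl : G →* Monoid.Coprod G H) '' X ∪
        (Monoid.Coprod.inr : H →* Monoid.Coprod G H) '' X')) f g := by
  obtain ⟨t⟩ := Transversal.nonempty_quotient hφ
  obtain ⟨t'⟩ := Transversal.nonempty_quotient hψ
  have := infinite_quotient_range φ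
  have := infinite_quotient_range ψ
  obtain ⟨_, _, ⟨T⟩⟩ := TreeOfSpaces.exists_model ((1 : G) : G ⧸ φ.range) ((1 : H) : H ⧸ ψ.range)
  obtain ⟨f₁, g₁, h₁⟩ := exists_coarseEq_tree t t' T (Amalgam.inl φ ψ) (Amalgam.inr φ ψ)
    (Amalgam.inl_eq_inr φ ψ) (Amalgam.range_inl_sup_range_inr φ ψ)
    (fun α β h => Amalgam.exists_lift φ ψ α β h) hX hX'
  obtain ⟨T₁, h₂⟩ := t.exists_coarseEq_refine hX T (relationMap_symm wordRel_symm t'.proj)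
    (t'.exists_within_relationMap hX')
  obtain ⟨T₂, h₃⟩ := t'.exists_coarseEq_refine hX' T₁.swap (wordRel_symm (S := X))
    fun g g' => ⟨_, within_wordNorm hX g g'⟩
  rw [T₁.adj_swap] at h₃
  obtain ⟨f₂, g₂, h₄⟩ := exists_coarseEq_tree (Transversal.trivial G) (Transversal.trivial H)
    T₂.swap (Monoid.Coprod.inl : G →* Monoid.Coprod G H) Monoid.Coprod.inr (fun _ => by simp)
    Monoid.Coprod.range_inl_sup_range_inr
    (fun α β _ => ⟨Monoid.Coprod.lift α β, Monoid.Coprod.lift_apply_inl α β,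
      Monoid.Coprod.lift_apply_inr α β⟩) hX hX'
  rw [T₂.adj_swap] at h₄
  simp only [Transversal.trivial, Relation.map_id_id] at h₄
  exact ⟨_, _, ((h₁.trans h₂).trans h₃).trans h₄.symm⟩

end Amalgam

/-- Papasoglu–Whyte: for infinite finitely generated `G`, `H` and a common finite subgroup
`F`, the amalgam `G *_F H` is quasi-isometric to the free product `G ∗ H`; consequently
their `ℓ^p` compression exponents agree for every `p ≥ 1`. -/
theorem stmt16 {G H F : Type*} [Group G] [Group H] [Group F]
    [Infinite G] [Infinite H] [Finite F]
    (φ : F →* G) (ψ : F →* H) (hφ : Function.Injective φ) (hψ : Function.Injective ψ)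
    (S : Set G) (T : Set H) (hSfin : S.Finite) (hTfin : T.Finite)
    (hSgen : Subgroup.closure S = ⊤) (hTgen : Subgroup.closure T = ⊤)
    (SCop : Set (Monoid.Coprod G H)) (SAm : Set (Amalgam G H F φ ψ))
    (hSCop : SCop = ((Monoid.Coprod.inl : G →* Monoid.Coprod G H) '' S) ∪
      ((Monoid.Coprod.inr : H →* Monoid.Coprod G H) '' T))
    (hSAm : SAm = (QuotientGroup.mk '' SCop : Set (Amalgam G H F φ ψ))) :
    (∃ (Φ : Amalgam G H F φ ψ → Monoid.Coprod G H) (L C : ℝ), 0 < L ∧ 0 < C ∧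
      (∀ a b : Amalgam G H F φ ψ,
        L⁻¹ * wordDist SAm a b - C ≤ wordDist SCop (Φ a) (Φ b) ∧
          wordDist SCop (Φ a) (Φ b) ≤ L * wordDist SAm a b + C) ∧
      (∀ g : Monoid.Coprod G H, ∃ a : Amalgam G H F φ ψ, wordDist SCop g (Φ a) ≤ C)) ∧
    ∀ p : ℝ, 1 ≤ p → compExp p (wordDist SAm) = compExp p (wordDist SCop) := by
  subst hSCop
  have hSAm' : SAm = Amalgam.inl φ ψ '' S ∪ Amalgam.inr φ ψ '' T := by
    rw [hSAm, Set.image_union, Set.image_image, Set.image_image]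
    rfl
  subst hSAm'
  obtain ⟨f, g, h⟩ := Amalgam.exists_coarseEq_coprod φ ψ hφ hψ hSgen hTgen
  have hA := closure_image_union_image (Amalgam.range_inl_sup_range_inr φ ψ) hSgen hTgen
  have hC := closure_image_union_image
    (Monoid.Coprod.range_inl_sup_range_inr (G := G) (H := H)) hSgen hTgen
  obtain ⟨L, hL, hf, hfg⟩ := h.wordDist_le hA hC
  obtain ⟨M, hM, hg, -⟩ := h.symm.wordDist_le hC hA
  refine ⟨⟨f, L, L, hL, hL, hf, fun x => ⟨g x, hfg x⟩⟩, fun p _ => congrArg sSup ?_⟩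
  exact (compExp_subset wordDist_nonneg wordDist_nonneg g hM hg).antisymm
    (compExp_subset wordDist_nonneg wordDist_nonneg f hL hf)
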